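/- Suppose integers x₀, y₀ satisfy x₀ | y₀³ + y₀ + 1 and y₀ | x₀³ + x₀ + 1, and let x₁ be the integer with x₀·x₁ = y₀³ + y₀ + 1. Then x₁ | y₀³ + y₀ + 1 and y₀ | x₁³ + x₁² + 1; that is, (y₀, x₁) is a solution to the system S_{2,1}. -/

import Mathlib

theorem stmt_4 (x₀ y₀ x₁ : ℤ) (hx : x₀ ≠ 0) (hy : y₀ ≠ 0)
    (h1 : x₀ ∣ y₀^3 + y₀ + 1) (h2 : y₀ ∣ x₀^3 + x₀ + 1)
    (hx1 : x₀ * x₁ = y₀^3 + y₀ + 1) :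
    x₁ ∣ y₀^3 + y₀ + 1 ∧ y₀ ∣ x₁^3 + x₁^2 + 1 := by
  obtain ⟨k, hk⟩ := h2
  refine ⟨Dvd.intro_left x₀ hx1, x₁^3 * k
    - (y₀^2 + 1) * (x₁^2 + (x₀ * x₁)^2 + x₀ * x₁ + 1), ?_⟩
  linear_combination x₁^3 * hk - (x₁^2 + (x₀ * x₁)^2 + x₀ * x₁ + 1) * hx1
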